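/- arXiv:2510.08751 — 6 statements merged into one kernel-verified Lean document; each statement's English description precedes it below -/
import Mathlib

section
/- The affine control system on ℝ² given by ẇ = A(u)w + Cu, where A(u) = μ·[[1,0],[α+u,1]] and C = (μ,0)ᵀ (equivalently ẏ = μ(y+u), ż = μ(z + (u+α)y)), admits a control set C^A with nonempty interior such that the set of equilibria ℰ = {(−u, u(u+α)) : u ∈ Ω} is contained in closure(C^A) and (−u, u(u+α)) ∈ interior(C^A) for every u ∈ (u_*,u^*) with u ≠ −α. Moreover, C^A is an open set if μ > 0 and a closed set if μ < 0. -/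
open Set Matrix

noncomputable section

/-- Vectors in the plane. -/
abbrev V2 := Fin 2 → ℝ

/-- The standard symplectic form on `ℝ²`: `ω(v,w) = v₁w₂ − v₂w₁`. -/
def omega2 (v w : V2) : ℝ := v 0 * w 1 - v 1 * w 0

/-- Counterclockwise rotation by `π/2`. -/
def theta (v : V2) : V2 := ![-(v 1), v 0]

/-- `u` is piecewise constant on `[0,∞)`: on every interval `[0,T]` it is a finite
step function (right-continuous convention). -/
def PiecewiseConst (u : ℝ → ℝ) : Prop :=
  ∀ T : ℝ, 0 ≤ T → ∃ (n : ℕ) (τ : ℕ → ℝ), τ 0 = 0 ∧ StrictMono τ ∧ T ≤ τ n ∧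
    ∀ i < n, ∀ s ∈ Ico (τ i) (τ (i + 1)), u s = u (τ i)

/-- Admissible controls: piecewise constant functions with values in `Ω`. -/
def Admissible (Ω : Set ℝ) (u : ℝ → ℝ) : Prop :=
  (∀ t, u t ∈ Ω) ∧ PiecewiseConst u

/-- `x` is a trajectory of the control system `ẋ = f(u(t), x)` on `[0,∞)`
with control `u`. -/
def IsTraj {M : Type*} [NormedAddCommGroup M] [NormedSpace ℝ M]
    (f : ℝ → M → M) (u : ℝ → ℝ) (x : ℝ → M) : Prop :=
  ContinuousOn x (Ici 0) ∧
    ∀ t ∈ Ici (0 : ℝ), HasDerivWithinAt x (f (u t) (x t)) (Ici t) t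

/-- The positive orbit `O⁺(p)` of the control system `f` with control range `Ω`. -/
def PosOrbit {M : Type*} [NormedAddCommGroup M] [NormedSpace ℝ M]
    (f : ℝ → M → M) (Ω : Set ℝ) (p : M) : Set M :=
  {q | ∃ (u : ℝ → ℝ) (x : ℝ → M) (T : ℝ), Admissible Ω u ∧ IsTraj f u x ∧
    x 0 = p ∧ 0 ≤ T ∧ x T = q}

/-- The two defining properties of a control set: (i) for every `p ∈ C` there is an
admissible control keeping the trajectory in `C` for all positive times;
(ii) `C ⊆ cl O⁺(p)` for all `p ∈ C`.  (Nonemptiness is also required.) -/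
def ControlSetProp {M : Type*} [NormedAddCommGroup M] [NormedSpace ℝ M]
    (f : ℝ → M → M) (Ω : Set ℝ) (C : Set M) : Prop :=
  C.Nonempty ∧
  (∀ p ∈ C, ∃ (u : ℝ → ℝ) (x : ℝ → M), Admissible Ω u ∧ IsTraj f u x ∧ x 0 = p ∧
      ∀ t : ℝ, 0 ≤ t → x t ∈ C) ∧
  (∀ p ∈ C, C ⊆ closure (PosOrbit f Ω p))

/-- A control set: a set satisfying `ControlSetProp`, maximal w.r.t. set inclusion
among such sets. -/
def IsControlSet {M : Type*} [NormedAddCommGroup M] [NormedSpace ℝ M]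
    (f : ℝ → M → M) (Ω : Set ℝ) (C : Set M) : Prop :=
  ControlSetProp f Ω C ∧ ∀ C', ControlSetProp f Ω C' → C ⊆ C' → C = C'

/-- The right-hand side of the linear control system `Σ_ℍ` on the Heisenberg group
`ℍ = ℝ² × ℝ`:  `v̇ = Av + uζ`, `ż = (tr A) z + uα + ω(v, θη + (u/2)ζ)`. -/
def heisF (A : Matrix (Fin 2) (Fin 2) ℝ) (η ζ : V2) (α : ℝ) (u : ℝ)
    (p : V2 × ℝ) : V2 × ℝ :=
  (A.mulVec p.1 + u • ζ,
    A.trace * p.2 + u * α + omega2 p.1 (theta η + (u / 2) • ζ))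

/-- The right-hand side of the planar linear control system `v̇ = Av + uζ`. -/
def planF (A : Matrix (Fin 2) (Fin 2) ℝ) (ζ : V2) (u : ℝ) (v : V2) : V2 :=
  A.mulVec v + u • ζ

/-- The derivation `𝒟(v,z) = (Av, ω(v,θη) + (tr A) z)` of the Heisenberg Lie
algebra associated to the drift of `Σ_ℍ`. -/
def Dmap (A : Matrix (Fin 2) (Fin 2) ℝ) (η : V2) (p : V2 × ℝ) : V2 × ℝ :=
  (A.mulVec p.1, omega2 p.1 (theta η) + A.trace * p.2)

/-- The right-hand side of the planar affine system `ẇ = A(u)w + Cu`, i.e.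
`ẏ = μ(y+u)`, `ż = μ(z + (u+α)y)`. -/
def sysA (μ α : ℝ) (u : ℝ) (w : ℝ × ℝ) : ℝ × ℝ :=
  (μ * (w.1 + u), μ * (w.2 + (u + α) * w.1))

/-- The solution at time `t` of `sysA` with constant control `v` starting at `p`. -/
def flowA (μ α v t : ℝ) (p : ℝ × ℝ) : ℝ × ℝ :=
  (Real.exp (μ * t) * (p.1 + v) - v,
    v * (v + α) + Real.exp (μ * t) * (p.2 - v * (v + α) + μ * t * ((v + α) * (p.1 + v))))

/-- The equilibrium of `sysA` with constant control `v`. -/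
def eqA (α v : ℝ) : ℝ × ℝ := (-v, v * (v + α))

/-- `q` is obtained from `p` by following finitely many constant-control flows forward. -/
def ReachA (μ α : ℝ) (Ω : Set ℝ) : ℝ × ℝ → ℝ × ℝ → Prop :=
  Relation.ReflTransGen fun p q => ∃ v ∈ Ω, ∃ t, 0 ≤ t ∧ q = flowA μ α v t p

lemma flowA_zero (μ α v : ℝ) (p : ℝ × ℝ) : flowA μ α v 0 p = p := by
  ext <;> simp [flowA]

lemma flowA_eqA (μ α v t : ℝ) : flowA μ α v t (eqA α v) = eqA α v := by
  ext <;> simp [flowA, eqA]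

lemma flowA_neg (μ α v t : ℝ) (p : ℝ × ℝ) : flowA (-μ) α v t (flowA μ α v t p) = p := by
  have h : Real.exp (-(μ * t)) * Real.exp (μ * t) = 1 := by rw [← Real.exp_add]; simp
  ext
  · simp only [flowA, neg_mul]
    linear_combination (p.1 + v) * h
  · simp only [flowA, neg_mul]
    linear_combination (p.2 - v * (v + α)) * h

lemma continuous_flowA (μ α v t : ℝ) : Continuous (flowA μ α v t) := by
  unfold flowA; fun_prop

lemma continuous_eqA (α : ℝ) : Continuous (eqA α) := by
  unfold eqA; fun_prop

lemma hasDerivAt_flowA (μ α v t : ℝ) (p : ℝ × ℝ) :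
    HasDerivAt (fun s => flowA μ α v s p) (sysA μ α v (flowA μ α v t p)) t := by
  have hl : HasDerivAt (fun s : ℝ => μ * s) μ t := by
    simpa using (hasDerivAt_id t).const_mul μ
  have he := hl.exp
  have h1 := (he.mul_const (p.1 + v)).sub_const v
  have h2 := (he.mul ((hl.mul_const ((v + α) * (p.1 + v))).const_add
    (p.2 - v * (v + α)))).const_add (v * (v + α))
  refine (h1.prodMk h2).congr_deriv ?_
  ext <;> simp [sysA, flowA] <;> ring

lemma isTraj_flowA (μ α v : ℝ) (p : ℝ × ℝ) :
    IsTraj (sysA μ α) (fun _ => v) (fun t => flowA μ α v t p) :=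
  ⟨fun t _ => (hasDerivAt_flowA μ α v t p).continuousAt.continuousWithinAt,
    fun t _ => (hasDerivAt_flowA μ α v t p).hasDerivWithinAt⟩

lemma admissible_const {Ω : Set ℝ} {v : ℝ} (hv : v ∈ Ω) : Admissible Ω (fun _ => v) :=
  ⟨fun _ => hv, fun T _ => ⟨⌈T⌉₊, fun i => i, by simp, Nat.strictMono_cast, Nat.le_ceil T,
    fun _ _ _ _ => rfl⟩⟩

/-- A solution with constant control coincides with the flow. -/
lemma eq_flowA_of_hasDerivWithinAt {μ α v a b : ℝ} {x : ℝ → ℝ × ℝ} (hab : a ≤ b)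
    (hc : ContinuousOn x (Icc a b))
    (hd : ∀ s ∈ Ico a b, HasDerivWithinAt x (sysA μ α v (x s)) (Ici s) s) :
    x b = flowA μ α v (b - a) (x a) := by
  have key : ∀ s ∈ Icc a b, flowA μ α v (a - s) (x s) = flowA μ α v (a - a) (x a) := by
    refine constant_of_has_deriv_right_zero (f := fun s => flowA μ α v (a - s) (x s)) ?_ ?_
    · have h1 := continuous_fst.comp_continuousOn hc
      have h2 := continuous_snd.comp_continuousOn hc
      simp only [Function.comp_def] at h1 h2
      unfold flowA
      fun_prop
    · intro s hs
      have hl : HasDerivWithinAt (fun s : ℝ => μ * (a - s)) (-μ) (Ici s) s := by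
        simpa using ((hasDerivWithinAt_id s (Ici s)).const_sub a).const_mul μ
      have hx1 : HasDerivWithinAt (fun s => (x s).1) (μ * ((x s).1 + v)) (Ici s) s :=
        (hasFDerivAt_fst (𝕜 := ℝ) (p := x s)).comp_hasDerivWithinAt s (hd s hs)
      have hx2 : HasDerivWithinAt (fun s => (x s).2)
          (μ * ((x s).2 + (v + α) * (x s).1)) (Ici s) s :=
        (hasFDerivAt_snd (𝕜 := ℝ) (p := x s)).comp_hasDerivWithinAt s (hd s hs)
      have he := hl.exp
      have h1 := (he.mul (hx1.add_const v)).sub_const v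
      have h2 := (he.mul ((hx2.sub_const (v * (v + α))).add
        (hl.mul ((hx1.add_const v).const_mul (v + α))))).const_add (v * (v + α))
      refine (h1.prodMk h2).congr_deriv ?_
      ext <;> simp <;> ring
  have h := key b ⟨hab, le_rfl⟩
  rw [sub_self, flowA_zero] at h
  rw [← h]
  have := flowA_neg (-μ) α v (b - a) (x b)
  rw [neg_neg] at this
  rw [show flowA μ α v (a - b) (x b) = flowA (-μ) α v (b - a) (x b) by
    simp only [flowA, show -μ * (b - a) = μ * (a - b) by ring]]
  exact this.symm

lemma ReachA.trans {μ α : ℝ} {Ω : Set ℝ} {p q r : ℝ × ℝ} (h : ReachA μ α Ω p q)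
    (h' : ReachA μ α Ω q r) : ReachA μ α Ω p r :=
  Relation.ReflTransGen.trans h h'

lemma reachA_flowA (μ α : ℝ) {Ω : Set ℝ} {v t : ℝ} (hv : v ∈ Ω) (ht : 0 ≤ t) (p : ℝ × ℝ) :
    ReachA μ α Ω p (flowA μ α v t p) :=
  .single ⟨v, hv, t, ht, rfl⟩

lemma ReachA.reverse {μ α : ℝ} {Ω : Set ℝ} {p q : ℝ × ℝ} (h : ReachA μ α Ω p q) :
    ReachA (-μ) α Ω q p := by
  induction h with
  | refl => exact .refl
  | tail _ h ih =>
    obtain ⟨v, hv, t, ht, rfl⟩ := h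
    exact .head ⟨v, hv, t, ht, (flowA_neg μ α v t _).symm⟩ ih

lemma ReachA.of_neg {μ α : ℝ} {Ω : Set ℝ} {p q : ℝ × ℝ} (h : ReachA (-μ) α Ω q p) :
    ReachA μ α Ω p q := by
  simpa using h.reverse

lemma ReachA.exists_continuous {μ α : ℝ} {Ω : Set ℝ} {p q : ℝ × ℝ} (h : ReachA μ α Ω p q) :
    ∃ g : ℝ × ℝ → ℝ × ℝ, Continuous g ∧ g p = q ∧ ∀ p', ReachA μ α Ω p' (g p') := by
  induction h with
  | refl => exact ⟨id, continuous_id, rfl, fun _ => .refl⟩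
  | tail _ h ih =>
    obtain ⟨v, hv, t, ht, rfl⟩ := h
    obtain ⟨g, hg, rfl, hr⟩ := ih
    exact ⟨fun p' => flowA μ α v t (g p'), (continuous_flowA μ α v t).comp hg, rfl,
      fun p' => (hr p').tail ⟨v, hv, t, ht, rfl⟩⟩

lemma IsTraj.reachA {μ α : ℝ} {Ω : Set ℝ} {u : ℝ → ℝ} {x : ℝ → ℝ × ℝ}
    (hx : IsTraj (sysA μ α) u x) (hu : Admissible Ω u) {T : ℝ} (hT : 0 ≤ T) :
    ReachA μ α Ω (x 0) (x T) := by
  obtain ⟨n, τ, h0, hmono, hTn, hconst⟩ := hu.2 T hT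
  have main : ∀ i ≤ n, ∀ t, 0 ≤ t → t ≤ τ i → ReachA μ α Ω (x 0) (x t) := by
    intro i
    induction i with
    | zero =>
      intro _ t ht ht'
      rw [h0] at ht'
      rw [le_antisymm ht' ht]
      exact .refl
    | succ i ih =>
      intro hi t ht ht'
      rcases le_total t (τ i) with h | h
      · exact ih (by omega) t ht h
      · have hτ : 0 ≤ τ i := h0 ▸ hmono.monotone (Nat.zero_le i)
        have heq : x t = flowA μ α (u (τ i)) (t - τ i) (x (τ i)) := by
          refine eq_flowA_of_hasDerivWithinAt h
            (hx.1.mono fun s hs => hτ.trans hs.1) fun s hs => ?_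
          rw [← hconst i (by omega) s ⟨hs.1, hs.2.trans_le ht'⟩]
          exact hx.2 s (hτ.trans hs.1)
        rw [heq]
        exact (ih (by omega) _ hτ le_rfl).trans (reachA_flowA μ α (hu.1 _) (sub_nonneg.2 h) _)
  exact main n le_rfl T hT hTn

lemma reachA_of_mem_posOrbit {μ α : ℝ} {Ω : Set ℝ} {p q : ℝ × ℝ}
    (h : q ∈ PosOrbit (sysA μ α) Ω p) : ReachA μ α Ω p q := by
  obtain ⟨u, x, T, hu, hx, rfl, hT, rfl⟩ := h
  exact hx.reachA hu hT

/-- The control equal to `v` on `[0,t)` and to the shift of `u` afterwards. -/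
lemma Admissible.concat {Ω : Set ℝ} {u : ℝ → ℝ} (hu : Admissible Ω u) {v t : ℝ} (hv : v ∈ Ω)
    (ht : 0 < t) : Admissible Ω (fun s => if s < t then v else u (s - t)) := by
  refine ⟨fun s => ?_, fun T _ => ?_⟩
  · dsimp only
    split_ifs
    exacts [hv, hu.1 _]
  · obtain ⟨n, τ, h0, hmono, hTn, hconst⟩ := hu.2 (max (T - t) 0) (le_max_right _ _)
    refine ⟨n + 1, fun i => Nat.casesOn i 0 fun j => t + τ j, rfl, ?_, ?_, ?_⟩
    · refine strictMono_nat_of_lt_succ fun i => ?_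
      cases i with
      | zero => simpa [h0] using ht
      | succ j => simpa using hmono (Nat.lt_succ_self j)
    · have := le_max_left (T - t) 0
      change T ≤ t + τ n
      linarith
    · intro i hi s hs
      cases i with
      | zero =>
        have hs' : s < t := by simpa [h0] using hs.2
        simp [hs', ht]
      | succ j =>
        have hτ : 0 ≤ τ j := h0 ▸ hmono.monotone (Nat.zero_le j)
        have hs1 : t + τ j ≤ s := hs.1
        have hs2 : s < t + τ (j + 1) := hs.2
        have e1 : ¬ s < t := by linarith
        have e2 : ¬ t + τ j < t := by linarith
        simp only [e1, e2, if_false, add_sub_cancel_left]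
        exact hconst j (by omega) _ ⟨by linarith, by linarith⟩

lemma IsTraj.concat {μ α : ℝ} {u : ℝ → ℝ} {x : ℝ → ℝ × ℝ} (hx : IsTraj (sysA μ α) u x)
    {v t : ℝ} {p : ℝ × ℝ} (hp : x 0 = flowA μ α v t p) :
    IsTraj (sysA μ α) (fun s => if s < t then v else u (s - t))
      (fun s => if s < t then flowA μ α v s p else x (s - t)) := by
  have hshift : ∀ s, t ≤ s → HasDerivWithinAt (fun r => x (r - t))
      (sysA μ α (u (s - t)) (x (s - t))) (Ici s) s := fun s hs => by
    have h1 := hx.2 (s - t) (sub_nonneg.2 hs)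
    have h2 := h1.scomp s (((hasDerivWithinAt_id s (Ici s)).sub_const t))
      (fun r (hr : s ≤ r) => by simpa using hr)
    simpa [Function.comp_def] using h2
  have hcongr : EqOn (fun s => if s < t then flowA μ α v s p else x (s - t))
      (fun s => flowA μ α v s p) (Iic t) := fun s (hs : s ≤ t) => by
    rcases hs.lt_or_eq with h | rfl
    · simp [h]
    · simp [hp]
  have hderiv : ∀ s, HasDerivWithinAt (fun s => if s < t then flowA μ α v s p else x (s - t))
      (sysA μ α (if s < t then v else u (s - t))
        (if s < t then flowA μ α v s p else x (s - t))) (Ici s) s := fun s => by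
    by_cases hs : s < t
    · simp only [hs, if_true]
      refine ((hasDerivAt_flowA μ α v s p).congr_of_eventuallyEq ?_).hasDerivWithinAt
      filter_upwards [Iio_mem_nhds hs] with r hr
      exact hcongr (mem_Iic.2 (le_of_lt hr))
    · have hs' := not_lt.1 hs
      simp only [hs, if_false]
      refine (hshift s hs').congr (fun r hr => ?_) (by simp [hs])
      simp [not_lt.2 (hs'.trans hr)]
  refine ⟨fun s _ => ?_, fun s _ => hderiv s⟩
  by_cases hs : s ≤ t
  · have hleft : ContinuousWithinAt
        (fun s => if s < t then flowA μ α v s p else x (s - t)) (Iic s) s :=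
      ((hasDerivAt_flowA μ α v s p).continuousAt.continuousWithinAt).congr
        (fun r (hr : r ≤ s) => hcongr (hr.trans hs)) (hcongr hs)
    exact (continuousAt_iff_continuous_left_right.2
      ⟨hleft, (hderiv s).continuousWithinAt⟩).continuousWithinAt
  · have hs' := not_le.1 hs
    have hc : ContinuousAt x (s - t) :=
      hx.1.continuousAt (Ici_mem_nhds (sub_pos.2 hs'))
    have hc' : ContinuousAt (fun r => x (r - t)) s :=
      ContinuousAt.comp (f := fun r => r - t) hc (by fun_prop)
    refine (hc'.congr ?_).continuousWithinAt
    filter_upwards [Ioi_mem_nhds hs'] with r hr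
    simp [(mem_Ioi.1 hr).not_gt]

/-- Reachability is realized by a trajectory that passes only through points reaching the
target until the target is hit, and then follows the flow with constant control `w`. -/
lemma ReachA.exists_traj {μ α : ℝ} {Ω : Set ℝ} {p q : ℝ × ℝ} (h : ReachA μ α Ω p q)
    {w : ℝ} (hw : w ∈ Ω) :
    ∃ (u : ℝ → ℝ) (x : ℝ → ℝ × ℝ) (T : ℝ), Admissible Ω u ∧ IsTraj (sysA μ α) u x ∧
      x 0 = p ∧ 0 ≤ T ∧ x T = q ∧
      ∀ s, 0 ≤ s → ReachA μ α Ω (x s) q ∨ ∃ r, x s = flowA μ α w r q := by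
  induction h using Relation.ReflTransGen.head_induction_on with
  | refl =>
    exact ⟨fun _ => w, fun t => flowA μ α w t q, 0, admissible_const hw, isTraj_flowA μ α w q,
      flowA_zero .., le_rfl, flowA_zero .., fun s _ => .inr ⟨s, rfl⟩⟩
  | @head p p' h hr ih =>
    obtain ⟨v, hv, t, ht, rfl⟩ := h
    obtain ⟨u, x, T, hu, hx, hx0, hT, hxT, hs⟩ := ih
    rcases ht.eq_or_lt with rfl | ht
    · exact ⟨u, x, T, hu, hx, by rw [hx0, flowA_zero], hT, hxT, hs⟩
    refine ⟨_, _, t + T, hu.concat hv ht, hx.concat hx0, by simp [ht, flowA_zero],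
      by positivity, by simp [hT, hxT], fun s hs0 => ?_⟩
    by_cases hst : s < t
    · left
      simp only [hst, if_true]
      have h1 : flowA μ α v t p = flowA μ α v (t - s) (flowA μ α v s p) := by
        have he : Real.exp (μ * t) = Real.exp (μ * (t - s)) * Real.exp (μ * s) := by
          rw [← Real.exp_add]; ring_nf
        ext <;> simp only [flowA, he] <;> ring
      exact .head ⟨v, hv, t - s, sub_nonneg.2 hst.le, h1⟩ hr
    · simp only [hst, if_false]
      exact hs _ (sub_nonneg.2 (not_lt.1 hst))

lemma ReachA.mem_posOrbit {μ α : ℝ} {Ω : Set ℝ} {p q : ℝ × ℝ} (h : ReachA μ α Ω p q)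
    {w : ℝ} (hw : w ∈ Ω) : q ∈ PosOrbit (sysA μ α) Ω p := by
  obtain ⟨u, x, T, hu, hx, hx0, hT, hxT, -⟩ := h.exists_traj hw
  exact ⟨u, x, T, hu, hx, hx0, hT, hxT⟩

/-- Local controllability at regular equilibria. -/
lemma reachA_mem_nhds_eqA {μ α : ℝ} {Ω : Set ℝ} (hμ : μ ≠ 0) {u : ℝ} (hu : Ω ∈ nhds u)
    (huα : u ≠ -α) : {q | ReachA μ α Ω (eqA α u) q} ∈ nhds (eqA α u) := by
  set E := Real.exp μ with hE
  have hE0 : E ≠ 0 := (Real.exp_pos μ).ne'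
  have hE1 : E - 1 ≠ 0 := by
    rw [sub_ne_zero, hE, Ne, Real.exp_eq_one_iff]
    exact hμ
  have hk : u + α ≠ 0 := fun h => huα (by linarith)
  let F : ℝ × ℝ → ℝ × ℝ := fun a => flowA μ α (u + a.2) 1 (flowA μ α (u + a.1) 1 (eqA α u))
  set m := (2 * u + α) * (1 - E) + E * μ * (u + α) with hm
  set l := E * (m + μ * (u + α) * (E - 1)) with hl
  set k := 1 - E + E * μ with hk'
  let c1 : ℝ × ℝ →L[ℝ] ℝ := ContinuousLinearMap.fst ℝ ℝ ℝ
  let c2 : ℝ × ℝ →L[ℝ] ℝ := ContinuousLinearMap.snd ℝ ℝ ℝ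
  let L : ℝ × ℝ →L[ℝ] ℝ × ℝ :=
    ((E * (E - 1)) • c1 + (E - 1) • c2).prod (l • c1 + m • c2)
  have hF : F = fun a => (-u + (E * (E - 1) * a.1 + (E - 1) * a.2),
      u * (u + α) + (l * a.1 + m * a.2
        + (k * (a.2 * a.2) + (E * k * (a.1 * a.1) + E * μ * (E - 1) * (a.1 * a.2))))) := by
    funext a
    ext <;> simp only [F, flowA, eqA, mul_one, ← hE, hl, hm, hk'] <;> ring
  have hd : HasStrictFDerivAt F L 0 := by
    rw [hF]
    have d1 : HasStrictFDerivAt (fun a : ℝ × ℝ => a.1) c1 0 := hasStrictFDerivAt_fst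
    have d2 : HasStrictFDerivAt (fun a : ℝ × ℝ => a.2) c2 0 := hasStrictFDerivAt_snd
    refine HasStrictFDerivAt.prodMk (((d1.const_mul _).add (d2.const_mul _)).const_add _) ?_
    refine HasStrictFDerivAt.congr_fderiv ((((d1.const_mul l).add (d2.const_mul m)).add
      (((d2.mul d2).const_mul k).add (((d1.mul d1).const_mul (E * k)).add
        ((d1.mul d2).const_mul (E * μ * (E - 1)))))).const_add _) ?_
    ext <;> simp
  have hsurj : L.range = ⊤ := by
    rw [LinearMap.range_eq_top]
    rintro ⟨b1, b2⟩
    have hdet : E * (E - 1) * (E - 1) * μ * (u + α) ≠ 0 := by positivity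
    refine ⟨((-(m * b1) + (E - 1) * b2) / (E * (E - 1) * (E - 1) * μ * (u + α)),
      (l * b1 - E * (E - 1) * b2) / (E * (E - 1) * (E - 1) * μ * (u + α))), ?_⟩
    ext
    · simp [L, c1, c2]
      field_simp
      rw [hl]
      ring
    · simp [L, c1, c2]
      field_simp
      rw [hl]
      ring
  have hF0 : F 0 = eqA α u := by simp [F, flowA_eqA]
  have hmap := hd.map_nhds_eq_of_surj hsurj
  rw [hF0] at hmap
  rw [← hmap, Filter.mem_map]
  have t1 : Filter.Tendsto (fun a : ℝ × ℝ => u + a.1) (nhds 0) (nhds u) := by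
    have : Continuous (fun a : ℝ × ℝ => u + a.1) := by fun_prop
    simpa using this.tendsto 0
  have t2 : Filter.Tendsto (fun a : ℝ × ℝ => u + a.2) (nhds 0) (nhds u) := by
    have : Continuous (fun a : ℝ × ℝ => u + a.2) := by fun_prop
    simpa using this.tendsto 0
  filter_upwards [t1 hu, t2 hu] with a h1 h2
  exact (reachA_flowA μ α h1 zero_le_one _).trans (reachA_flowA μ α h2 zero_le_one _)

lemma tendsto_flowA {μ : ℝ} (hμ : μ < 0) (α v : ℝ) (p : ℝ × ℝ) :
    Filter.Tendsto (fun t => flowA μ α v t p) Filter.atTop (nhds (eqA α v)) := by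
  have hl : Filter.Tendsto (fun t : ℝ => -μ * t) Filter.atTop Filter.atTop :=
    Filter.tendsto_id.const_mul_atTop (neg_pos.2 hμ)
  have h0 := (Real.tendsto_pow_mul_exp_neg_atTop_nhds_zero 0).comp hl
  have h1 := (Real.tendsto_pow_mul_exp_neg_atTop_nhds_zero 1).comp hl
  simp only [Function.comp_def, pow_zero, one_mul, pow_one, neg_mul, neg_neg] at h0 h1
  have g1 := (h0.mul_const (p.1 + v)).sub_const v
  have g2 := ((h0.mul_const (p.2 - v * (v + α))).sub
    (h1.mul_const ((v + α) * (p.1 + v)))).const_add (v * (v + α))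
  have g := g1.prodMk_nhds g2
  refine (g.congr fun t => ?_).trans_eq ?_
  · ext
    · simp only [flowA]
    · simp only [flowA]
      ring
  · simp [eqA]

lemma reachA_eqA {μ α : ℝ} {Ω : Set ℝ} (hμ : μ < 0) {u : ℝ} (hu : Ω ∈ nhds u)
    (huα : u ≠ -α) (p : ℝ × ℝ) : ReachA μ α Ω p (eqA α u) := by
  have h := (tendsto_flowA hμ α u p).eventually
    (reachA_mem_nhds_eqA (neg_ne_zero.2 hμ.ne) hu huα)
  obtain ⟨t, ht, ht0⟩ := (h.and (Filter.eventually_ge_atTop 0)).exists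
  exact (reachA_flowA μ α (mem_of_mem_nhds hu) ht0 p).trans (ReachA.of_neg ht)

lemma eqA_reachA {μ α : ℝ} {Ω : Set ℝ} (hμ : 0 < μ) {u : ℝ} (hu : Ω ∈ nhds u)
    (huα : u ≠ -α) (p : ℝ × ℝ) : ReachA μ α Ω (eqA α u) p :=
  (reachA_eqA (neg_lt_zero.2 hμ) hu huα p).of_neg

/-- In the stable case the closure of the orbit of a regular equilibrium is a control set. -/
lemma isControlSet_closure_reachA {μ α : ℝ} {Ω : Set ℝ} (hμ : μ < 0) {u : ℝ}
    (hu : Ω ∈ nhds u) (huα : u ≠ -α) :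
    IsControlSet (sysA μ α) Ω (closure {q | ReachA μ α Ω (eqA α u) q}) := by
  have huΩ := mem_of_mem_nhds hu
  have hmem : eqA α u ∈ closure {q | ReachA μ α Ω (eqA α u) q} := subset_closure .refl
  refine ⟨⟨⟨_, hmem⟩, fun p hp => ?_, fun p _ => ?_⟩, fun C' hC' hsub => ?_⟩
  · refine ⟨_, _, admissible_const huΩ, isTraj_flowA μ α u p, flowA_zero .., fun t ht => ?_⟩
    exact map_mem_closure (continuous_flowA μ α u t) hp
      fun q hq => hq.trans (reachA_flowA μ α huΩ ht q)
  · exact closure_mono fun q hq => ((reachA_eqA hμ hu huα p).trans hq).mem_posOrbit huΩ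
  · exact hsub.antisymm ((hC'.2.2 _ (hsub hmem)).trans
      (closure_mono fun _ => reachA_of_mem_posOrbit))

/-- In the unstable case the set of points reaching a regular equilibrium is a control set. -/
lemma isControlSet_reachA {μ α : ℝ} {Ω : Set ℝ} (hμ : 0 < μ) {u : ℝ}
    (hu : Ω ∈ nhds u) (huα : u ≠ -α) :
    IsControlSet (sysA μ α) Ω {p | ReachA μ α Ω p (eqA α u)} := by
  have huΩ := mem_of_mem_nhds hu
  have hnhds : {p | ReachA μ α Ω p (eqA α u)} ∈ nhds (eqA α u) :=
    Filter.mem_of_superset (reachA_mem_nhds_eqA (neg_ne_zero.2 hμ.ne') hu huα)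
      fun p hp => ReachA.of_neg hp
  refine ⟨⟨⟨eqA α u, .refl⟩, fun p hp => ?_, fun p hp q _ => ?_⟩, fun C' hC' hsub => ?_⟩
  · obtain ⟨w, x, T, hw, hx, hx0, -, -, hs⟩ := ReachA.exists_traj hp huΩ
    refine ⟨w, x, hw, hx, hx0, fun t ht => ?_⟩
    rcases hs t ht with h | ⟨r, h⟩
    · exact h
    · rw [h, flowA_eqA]
      exact .refl
  · exact subset_closure ((ReachA.trans hp (eqA_reachA hμ hu huα q)).mem_posOrbit huΩ)
  · refine hsub.antisymm fun q hq => ?_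
    have h : eqA α u ∈ closure (PosOrbit (sysA μ α) Ω q) := hC'.2.2 q hq (hsub .refl)
    obtain ⟨r, hr, hr'⟩ := mem_closure_iff_nhds.1 h _ hnhds
    exact (reachA_of_mem_posOrbit hr').trans hr

lemma isOpen_reachA {μ α : ℝ} {Ω : Set ℝ} (hμ : μ ≠ 0) {u : ℝ}
    (hu : Ω ∈ nhds u) (huα : u ≠ -α) : IsOpen {p | ReachA μ α Ω p (eqA α u)} := by
  refine isOpen_iff_mem_nhds.2 fun p hp => ?_
  obtain ⟨g, hg, hgp, hr⟩ := ReachA.exists_continuous hp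
  have h := reachA_mem_nhds_eqA (neg_ne_zero.2 hμ) hu huα
  rw [← hgp] at h
  filter_upwards [hg.continuousAt h] with q hq
  rw [hgp] at hq
  exact (hr q).trans (ReachA.of_neg hq)

/-- In a set containing the regular equilibria, all equilibria lie in the closure. -/
lemma eqA_mem_closure {α u₁ u₂ : ℝ} (h : u₁ < u₂) {C : Set (ℝ × ℝ)}
    (hC : ∀ u ∈ Ioo u₁ u₂, u ≠ -α → eqA α u ∈ C) {u : ℝ} (hu : u ∈ Icc u₁ u₂) :
    eqA α u ∈ closure C := by
  have hd : Ioo u₁ u₂ ⊆ closure (Ioo u₁ u₂ ∩ {-α}ᶜ) :=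
    (dense_compl_singleton (-α)).open_subset_closure_inter isOpen_Ioo
  have hu' : u ∈ closure (Ioo u₁ u₂ ∩ {-α}ᶜ) := by
    rw [← closure_Ioo h.ne] at hu
    exact closure_minimal hd isClosed_closure hu
  exact map_mem_closure (continuous_eqA α) hu' fun v hv => hC v hv.1 hv.2

/-- the affine control system `ẏ = μ(y+u)`, `ż = μ(z+(u+α)y)`,
`u ∈ Ω = [u₁,u₂]`, admits a control set `C^A` with nonempty interior such that
the set of equilibria `{(−u, u(u+α)) : u ∈ Ω}` is contained in `cl C^A`, with
`(−u, u(u+α)) ∈ int C^A` for every `u ∈ (u₁,u₂)` with `u ≠ −α`; moreover `C^A`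
is open if `μ > 0` and closed if `μ < 0`. -/
theorem stmt11 (μ α u₁ u₂ : ℝ) (hμ : μ ≠ 0) (h₁ : u₁ < 0) (h₂ : 0 < u₂) :
    ∃ CA : Set (ℝ × ℝ), IsControlSet (sysA μ α) (Icc u₁ u₂) CA ∧
      (interior CA).Nonempty ∧
      (∀ u ∈ Icc u₁ u₂, ((-u, u * (u + α)) : ℝ × ℝ) ∈ closure CA) ∧
      (∀ u ∈ Ioo u₁ u₂, u ≠ -α → ((-u, u * (u + α)) : ℝ × ℝ) ∈ interior CA) ∧
      (0 < μ → IsOpen CA) ∧ (μ < 0 → IsClosed CA) := by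
  obtain ⟨u₀, hu₀, hu₀α⟩ : ∃ u₀ ∈ Ioo u₁ u₂, u₀ ≠ -α :=
    ((Ioo_infinite (h₁.trans h₂)).sdiff (finite_singleton (-α))).nonempty
  have hΩ : ∀ u ∈ Ioo u₁ u₂, Icc u₁ u₂ ∈ nhds u := fun u hu => Icc_mem_nhds hu.1 hu.2
  suffices H : ∃ CA : Set (ℝ × ℝ), IsControlSet (sysA μ α) (Icc u₁ u₂) CA ∧
      (∀ u ∈ Ioo u₁ u₂, u ≠ -α → eqA α u ∈ interior CA) ∧
      (0 < μ → IsOpen CA) ∧ (μ < 0 → IsClosed CA) by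
    obtain ⟨CA, hCA, hint, ho, hc⟩ := H
    exact ⟨CA, hCA, ⟨_, hint u₀ hu₀ hu₀α⟩,
      fun u hu => eqA_mem_closure (h₁.trans h₂)
        (fun v hv hvα => interior_subset (hint v hv hvα)) hu, hint, ho, hc⟩
  rcases hμ.lt_or_gt with hneg | hpos
  · refine ⟨_, isControlSet_closure_reachA hneg (hΩ u₀ hu₀) hu₀α, fun u hu huα => ?_,
      fun h => absurd h hneg.not_gt, fun _ => isClosed_closure⟩
    refine interior_mono subset_closure (mem_interior_iff_mem_nhds.2 ?_)
    exact Filter.mem_of_superset (reachA_mem_nhds_eqA hμ (hΩ u hu) huα)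
      fun q hq => (reachA_eqA hneg (hΩ u hu) huα _).trans hq
  · have ho := isOpen_reachA hμ (hΩ u₀ hu₀) hu₀α
    refine ⟨_, isControlSet_reachA hpos (hΩ u₀ hu₀) hu₀α, fun u hu huα => ?_,
      fun _ => ho, fun h => absurd h hpos.not_gt⟩
    rw [ho.interior_eq]
    exact eqA_reachA hpos (hΩ u hu) huα _
end
end

section
/- A linear map 𝒟 : ℝ² × ℝ → ℝ² × ℝ is a derivation of the Heisenberg Lie algebra 𝔥 (i.e. 𝒟[X,Y] = [𝒟X,Y] + [X,𝒟Y] for all X, Y ∈ 𝔥) if and only if there exist a real 2×2 matrix A and η ∈ ℝ² such that 𝒟(v,z) = (Av, ⟨η,v⟩ + (tr A)z) for all (v,z) ∈ ℝ² × ℝ. -/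
open Set Matrix

noncomputable section

/-- The bracket of the Heisenberg Lie algebra `𝔥 = ℝ² × ℝ`:
`[(ζ₁,α₁),(ζ₂,α₂)] = (0, ω(ζ₁,ζ₂))`. -/
def hbracket (x y : V2 × ℝ) : V2 × ℝ := ((0 : V2), omega2 x.1 y.1)

/-- A linear map on `ℝ² × ℝ` is determined by its values on the standard basis. -/
lemma map_eq_smul_basis (D : (V2 × ℝ) →ₗ[ℝ] V2 × ℝ) (p : V2 × ℝ) :
    D p = p.1 0 • D (![1, 0], 0) + p.1 1 • D (![0, 1], 0) + p.2 • D (0, 1) := by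
  rw [← map_smul, ← map_smul, ← map_smul, ← map_add, ← map_add]
  congr 1
  ext i
  · fin_cases i <;> simp
  · simp

/-- a linear map `𝒟 : ℝ² × ℝ → ℝ² × ℝ` is a derivation of the
Heisenberg Lie algebra `𝔥` if and only if there exist a real `2×2` matrix `A`
and `η ∈ ℝ²` such that `𝒟(v,z) = (Av, ⟨η,v⟩ + (tr A) z)`. -/
theorem stmt12 (D : (V2 × ℝ) →ₗ[ℝ] V2 × ℝ) :
    (∀ X Y : V2 × ℝ, D (hbracket X Y) = hbracket (D X) Y + hbracket X (D Y)) ↔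
    ∃ (A : Matrix (Fin 2) (Fin 2) ℝ) (η : V2), ∀ p : V2 × ℝ,
      D p = (A.mulVec p.1, η ⬝ᵥ p.1 + A.trace * p.2) := by
  constructor
  · intro h
    have hz : D (0, 1) = (0, (D (![1, 0], 0)).1 0 + (D (![0, 1], 0)).1 1) := by
      have h01 := h (![1, 0], 0) (![0, 1], 0)
      simpa [hbracket, omega2] using h01
    refine ⟨!![(D (![1, 0], 0)).1 0, (D (![0, 1], 0)).1 0;
        (D (![1, 0], 0)).1 1, (D (![0, 1], 0)).1 1],
      ![(D (![1, 0], 0)).2, (D (![0, 1], 0)).2], fun p => ?_⟩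
    rw [map_eq_smul_basis D p, hz]
    ext i
    · fin_cases i <;> simp [Matrix.mulVec, dotProduct, Fin.sum_univ_two] <;> ring
    · simp [dotProduct, Fin.sum_univ_two, Matrix.trace]
      ring
  · rintro ⟨A, η, h⟩ X Y
    ext i
    · simp [h, hbracket]
    · simp [h, hbracket, omega2, Matrix.trace, dotProduct, Fin.sum_univ_two]
      ring
end
end

section
/- A map Φ : ℍ → ℍ is a continuous group automorphism of the Heisenberg group ℍ (a continuous bijective homomorphism for the product *) if and only if there exist an invertible real 2×2 matrix P and ξ ∈ ℝ² such that Φ(v,z) = (Pv, ⟨ξ,v⟩ + (det P)z) for all (v,z) ∈ ℝ² × ℝ. -/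
open Set Matrix

noncomputable section

/-- The product of the Heisenberg group `ℍ = ℝ² × ℝ`:
`(v₁,z₁)*(v₂,z₂) = (v₁+v₂, z₁+z₂+ω(v₁,v₂)/2)`. -/
def hmul (p q : V2 × ℝ) : V2 × ℝ := (p.1 + q.1, p.2 + q.2 + omega2 p.1 q.1 / 2)

theorem omega2_swap (v w : V2) : omega2 w v = -omega2 v w := by
  simp only [omega2]; ring

theorem omega2_mulVec (P : Matrix (Fin 2) (Fin 2) ℝ) (v w : V2) :
    omega2 (P.mulVec v) (P.mulVec w) = P.det * omega2 v w := by
  simp only [omega2, Matrix.mulVec, dotProduct, Fin.sum_univ_two, Matrix.det_fin_two]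
  ring

theorem eq_zero_of_omega2_eq_zero {a : V2} (h : ∀ w, omega2 a w = 0) : a = 0 := by
  have h0 := h ![0, 1]
  have h1 := h ![1, 0]
  simp [omega2] at h0 h1
  ext i
  fin_cases i <;> simp [h0, h1]

theorem exists_linearMap_of_continuous_additive {E F : Type*} [AddCommGroup E] [Module ℝ E]
    [TopologicalSpace E] [ContinuousSMul ℝ E] [AddCommGroup F] [Module ℝ F] [TopologicalSpace F]
    [ContinuousSMul ℝ F] [T2Space F] (f : E → F) (hf : Continuous f)
    (hadd : ∀ x y, f (x + y) = f x + f y) : ∃ L : E →ₗ[ℝ] F, ∀ x, L x = f x :=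
  ⟨((AddMonoidHom.mk' f hadd).toRealLinearMap hf : E →L[ℝ] F), fun _ => rfl⟩

/-- A surjective homomorphism of `ℍ` maps the centre `{0} × ℝ` into itself. -/
theorem fst_apply_zero_eq_zero {Φ : V2 × ℝ → V2 × ℝ} (hs : Function.Surjective Φ)
    (hm : ∀ p q : V2 × ℝ, Φ (hmul p q) = hmul (Φ p) (Φ q)) (z : ℝ) : (Φ (0, z)).1 = 0 := by
  refine eq_zero_of_omega2_eq_zero fun w => ?_
  obtain ⟨q, hq⟩ := hs (w, 0)
  have hcomm : hmul (0, z) q = hmul q (0, z) := by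
    simp [hmul, omega2, add_comm]
  have h := congrArg Prod.snd (congrArg Φ hcomm)
  rw [hm, hm, hq] at h
  simp only [hmul, omega2_swap (Φ (0, z)).1 w] at h
  linarith

theorem exists_matrix_of_continuous_automorphism {Φ : V2 × ℝ → V2 × ℝ} (hc : Continuous Φ)
    (hb : Function.Bijective Φ) (hm : ∀ p q : V2 × ℝ, Φ (hmul p q) = hmul (Φ p) (Φ q)) :
    ∃ (P : Matrix (Fin 2) (Fin 2) ℝ) (ξ : V2), IsUnit P ∧
      ∀ p : V2 × ℝ, Φ p = (P.mulVec p.1, ξ ⬝ᵥ p.1 + P.det * p.2) := by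
  have hcen := fst_apply_zero_eq_zero hb.2 hm
  have hsplit : ∀ v z, Φ (v, z) = ((Φ (v, 0)).1, (Φ (v, 0)).2 + (Φ (0, z)).2) := by
    intro v z
    have h := hm (v, 0) (0, z)
    simpa [hmul, hcen, omega2] using h
  have hmul' : ∀ v w, Φ (v + w, omega2 v w / 2) = hmul (Φ (v, 0)) (Φ (w, 0)) := by
    intro v w
    simpa [hmul] using hm (v, 0) (w, 0)
  obtain ⟨L, hL⟩ := exists_linearMap_of_continuous_additive (fun v : V2 => (Φ (v, 0)).1)
    (by fun_prop) (fun v w => by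
      have h := congrArg Prod.fst (hmul' v w)
      rwa [hsplit] at h)
  obtain ⟨H, hH⟩ := exists_linearMap_of_continuous_additive (fun z : ℝ => (Φ (0, z)).2)
    (by fun_prop) (fun z w => by
      have h := congrArg Prod.snd (hm (0, z) (0, w))
      simpa [hmul, hcen, omega2] using h)
  have hHc : ∀ z, (Φ (0, z)).2 = H 1 * z := by
    intro z
    rw [← hH, mul_comm, ← smul_eq_mul, ← map_smul, smul_eq_mul, mul_one]
  set P := LinearMap.toMatrix' L with hP
  have hLP : ∀ v, (Φ (v, 0)).1 = P.mulVec v := by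
    intro v
    rw [← hL, hP, LinearMap.toMatrix'_mulVec]
  have hg : ∀ v w, (Φ (v + w, 0)).2 + H 1 * (omega2 v w / 2) =
      (Φ (v, 0)).2 + (Φ (w, 0)).2 + P.det * omega2 v w / 2 := by
    intro v w
    have h := congrArg Prod.snd (hmul' v w)
    rw [hsplit, hHc] at h
    simpa only [hmul, hLP, omega2_mulVec] using h
  have hdet : H 1 = P.det := by
    have h1 := hg ![1, 0] ![0, 1]
    have h2 := hg ![0, 1] ![1, 0]
    rw [add_comm ![0, 1] ![1, 0]] at h2
    simp only [omega2, Matrix.cons_val_zero, Matrix.cons_val_one] at h1 h2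
    linarith
  obtain ⟨G, hG⟩ := exists_linearMap_of_continuous_additive (fun v : V2 => (Φ (v, 0)).2)
    (by fun_prop) (fun v w => by
      have h := hg v w
      rw [hdet] at h
      linarith)
  have hne : P.det ≠ 0 := by
    intro h0
    have h : Φ (0, 1) = Φ (0, 0) := by
      ext1
      · rw [hcen, hcen]
      · rw [hHc, hHc, hdet, h0, zero_mul, zero_mul]
    simpa using hb.1 h
  refine ⟨P, fun i => G fun j => if i = j then 1 else 0, (Matrix.isUnit_iff_isUnit_det P).2 hne.isUnit, ?_⟩
  rintro ⟨v, z⟩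
  rw [hsplit, hLP, hHc, hdet, ← hG v, LinearMap.pi_apply_eq_sum_univ G v]
  simp only [dotProduct, smul_eq_mul, mul_comm]

theorem bijective_of_isUnit {P : Matrix (Fin 2) (Fin 2) ℝ} (hP : IsUnit P) (ξ : V2) :
    Function.Bijective fun p : V2 × ℝ => (P.mulVec p.1, ξ ⬝ᵥ p.1 + P.det * p.2) := by
  have hdet : IsUnit P.det := (Matrix.isUnit_iff_isUnit_det P).1 hP
  constructor
  · rintro ⟨v, z⟩ ⟨w, t⟩ h
    simp only [Prod.mk.injEq] at h
    obtain ⟨h1, h2⟩ := h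
    obtain rfl : v = w := Matrix.mulVec_injective_of_isUnit hP h1
    simpa [hdet.ne_zero] using h2
  · rintro ⟨w, t⟩
    refine ⟨(P⁻¹.mulVec w, (t - ξ ⬝ᵥ P⁻¹.mulVec w) / P.det), ?_⟩
    simp only [Matrix.mulVec_mulVec, Matrix.mul_nonsing_inv P hdet, Matrix.one_mulVec,
      mul_div_cancel₀ _ hdet.ne_zero, add_sub_cancel]

/-- a map `Φ : ℍ → ℍ` is a continuous group automorphism of the
Heisenberg group (a continuous bijective homomorphism for `*`) if and only if
there exist an invertible real `2×2` matrix `P` and `ξ ∈ ℝ²` such that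
`Φ(v,z) = (Pv, ⟨ξ,v⟩ + (det P) z)`. -/
theorem stmt13 (Φ : V2 × ℝ → V2 × ℝ) :
    (Continuous Φ ∧ Function.Bijective Φ ∧
      ∀ p q : V2 × ℝ, Φ (hmul p q) = hmul (Φ p) (Φ q)) ↔
    ∃ (P : Matrix (Fin 2) (Fin 2) ℝ) (ξ : V2), IsUnit P ∧
      ∀ p : V2 × ℝ, Φ p = (P.mulVec p.1, ξ ⬝ᵥ p.1 + P.det * p.2) := by
  refine ⟨fun ⟨hc, hb, hm⟩ => exists_matrix_of_continuous_automorphism hc hb hm, ?_⟩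
  rintro ⟨P, ξ, hP, hΦ⟩
  obtain rfl : Φ = fun p => (P.mulVec p.1, ξ ⬝ᵥ p.1 + P.det * p.2) := funext hΦ
  refine ⟨?_, bijective_of_isUnit hP ξ, fun p q => ?_⟩
  · simp only [dotProduct]
    fun_prop
  · simp only [hmul, omega2_mulVec, Matrix.mulVec_add, dotProduct_add, Prod.mk.injEq, true_and]
    ring
end
end

section
/- Let σ < 0 and u ∈ ℝ with σ < u, and define F : ℝ³ → ℝ by F(x,y,z) = 3zσ + y(y² − 2xσ). For (x₀,y₀,z₀) ∈ ℝ³ let φ(t) = (x₀ + y₀t + ut²/2, y₀ + ut, z₀ + (1/3)(2x₀u − y₀²)t) (the constant-control solution of ẋ = y, ẏ = u, ż = (1/3)(2xu − y²)). Then F(φ(t)) ≥ F(x₀,y₀,z₀) for all t ≥ 0, and if (y₀,u) ≠ (0,0) then F(φ(t)) > F(x₀,y₀,z₀) for all t > 0. Moreover, for u ≠ 0 one has the identity F(φ(t)) = F(x₀,y₀,z₀) + ((u−σ)/u)·[(y₀+ut)³ − y₀³], and for u = 0 one has F(φ(t)) = F(x₀,y₀,z₀) − 3ty₀²σ. -/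
noncomputable section

/-- The Lyapunov-type function `F(x,y,z) = 3zσ + y(y² − 2xσ)`. -/
def F16 (σ : ℝ) (p : ℝ × ℝ × ℝ) : ℝ :=
  3 * p.2.2 * σ + p.2.1 * (p.2.1 ^ 2 - 2 * p.1 * σ)

/-- The constant-control solution of `ẋ = y`, `ẏ = u`, `ż = (1/3)(2xu − y²)`
through `(x₀,y₀,z₀)`. -/
def φ16 (u x₀ y₀ z₀ : ℝ) (t : ℝ) : ℝ × ℝ × ℝ :=
  (x₀ + y₀ * t + u * t ^ 2 / 2, y₀ + u * t,
    z₀ + (2 * x₀ * u - y₀ ^ 2) / 3 * t)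

/-- Division-free form of the increment of `F` along a constant-control solution. -/
theorem F16_φ16 (σ u x₀ y₀ z₀ t : ℝ) :
    F16 σ (φ16 u x₀ y₀ z₀ t) = F16 σ (x₀, y₀, z₀) +
      (u - σ) * (t * (3 * y₀ ^ 2 + 3 * y₀ * (u * t) + (u * t) ^ 2)) := by
  simp only [F16, φ16]
  ring

/-- `F` is nondecreasing (strictly increasing if `(y₀,u) ≠ (0,0)`)
along the constant-control solutions, with the explicit identities
`F(φ(t)) = F(p₀) + ((u−σ)/u)((y₀+ut)³ − y₀³)` for `u ≠ 0` and
`F(φ(t)) = F(p₀) − 3ty₀²σ` for `u = 0`. -/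
theorem stmt16 (σ u : ℝ) (hσ : σ < 0) (hσu : σ < u) (x₀ y₀ z₀ : ℝ) :
    (∀ t : ℝ, 0 ≤ t → F16 σ (x₀, y₀, z₀) ≤ F16 σ (φ16 u x₀ y₀ z₀ t)) ∧
    (((y₀, u) : ℝ × ℝ) ≠ (0, 0) →
      ∀ t : ℝ, 0 < t → F16 σ (x₀, y₀, z₀) < F16 σ (φ16 u x₀ y₀ z₀ t)) ∧
    (u ≠ 0 → ∀ t : ℝ, F16 σ (φ16 u x₀ y₀ z₀ t) =
        F16 σ (x₀, y₀, z₀) + (u - σ) / u * ((y₀ + u * t) ^ 3 - y₀ ^ 3)) ∧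
    (u = 0 → ∀ t : ℝ, F16 σ (φ16 u x₀ y₀ z₀ t) =
        F16 σ (x₀, y₀, z₀) - 3 * t * y₀ ^ 2 * σ) := by
  have hpos : 0 < u - σ := sub_pos.mpr hσu
  refine ⟨fun t ht => ?_, fun hne t ht => ?_, fun hu t => ?_, fun hu t => ?_⟩
  · rw [F16_φ16]
    have hq : 0 ≤ 3 * y₀ ^ 2 + 3 * y₀ * (u * t) + (u * t) ^ 2 := by
      nlinarith [sq_nonneg (3 * y₀ + 2 * (u * t)), sq_nonneg y₀]
    exact le_add_of_nonneg_right (mul_nonneg hpos.le (mul_nonneg ht hq))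
  · rw [F16_φ16]
    have hq : 0 < 3 * y₀ ^ 2 + 3 * y₀ * (u * t) + (u * t) ^ 2 := by
      by_cases hy : y₀ = 0
      · have hu : u ≠ 0 := fun hu => hne (by rw [hy, hu])
        have hut : 0 < (u * t) ^ 2 := sq_pos_of_ne_zero (mul_ne_zero hu ht.ne')
        simpa [hy] using hut
      · have hy2 : 0 < y₀ ^ 2 := sq_pos_of_ne_zero hy
        nlinarith [sq_nonneg (3 * y₀ + 2 * (u * t))]
    exact lt_add_of_pos_right _ (mul_pos hpos (mul_pos ht hq))
  · rw [F16_φ16]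
    field_simp
    ring
  · rw [F16_φ16, hu]
    ring
end
end

section
/- Let μ > 0, σ < u_* < 0 < u^*, and u, y₀ ∈ [u_*,u^*], x₀, z₀ ∈ ℝ. Define G(x,y,z) = z + σy + σ²·log(y − σ) and φ(t) = (e^{μt}(x₀+u) − u, e^{−μt}(y₀−u) + u, z₀ + uy₀(1 − e^{−μt}) + u²(e^{−μt} + μt − 1)) (the constant-control solution of ẋ = μ(x+u), ẏ = μ(−y+u), ż = uμy). Then the y-component of φ(t) stays in [u_*,u^*] for t ≥ 0, the function t ↦ G(φ(t)) has derivative μ(u−σ)·y(t)²/(y(t)−σ) ≥ 0, where y(t) = e^{−μt}(y₀−u)+u, and if (y₀,u) ≠ (0,0) then G(φ(t)) > G(φ(0)) for all t > 0. -/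
open Set

noncomputable section

/-- The Lyapunov-type function `G(x,y,z) = z + σy + σ² log(y − σ)`. -/
def G17 (σ : ℝ) (p : ℝ × ℝ × ℝ) : ℝ :=
  p.2.2 + σ * p.2.1 + σ ^ 2 * Real.log (p.2.1 - σ)

/-- The constant-control solution of `ẋ = μ(x+u)`, `ẏ = μ(−y+u)`, `ż = uμy`
through `(x₀,y₀,z₀)`. -/
def φ17 (μ u x₀ y₀ z₀ : ℝ) (t : ℝ) : ℝ × ℝ × ℝ :=
  (Real.exp (μ * t) * (x₀ + u) - u, Real.exp (-(μ * t)) * (y₀ - u) + u,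
    z₀ + u * y₀ * (1 - Real.exp (-(μ * t))) + u ^ 2 * (Real.exp (-(μ * t)) + μ * t - 1))

/-- Exponential relaxation from `y` to `u` stays in every interval containing both. -/
theorem exp_relaxation_mem_Icc {a b u y r : ℝ} (hu : u ∈ Icc a b) (hy : y ∈ Icc a b)
    (hr : 0 ≤ r) : Real.exp (-r) * (y - u) + u ∈ Icc a b := by
  have h := (convex_Icc a b) hy hu (Real.exp_pos (-r)).le
    (sub_nonneg.2 (Real.exp_le_one_iff.2 (neg_nonpos.2 hr))) (add_sub_cancel _ _)
  convert h using 1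
  simp only [smul_eq_mul]
  ring

/-- The derivative of `G17` along the constant-control solution `φ17`. -/
theorem hasDerivAt_G17_φ17 {μ σ u y₀ t : ℝ} (x₀ z₀ : ℝ)
    (h : Real.exp (-(μ * t)) * (y₀ - u) + u - σ ≠ 0) :
    HasDerivAt (fun s : ℝ => G17 σ (φ17 μ u x₀ y₀ z₀ s))
      (μ * (u - σ) * (Real.exp (-(μ * t)) * (y₀ - u) + u) ^ 2 /
        (Real.exp (-(μ * t)) * (y₀ - u) + u - σ)) t := by
  have hlin : HasDerivAt (fun s : ℝ => μ * s) μ t := by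
    simpa using (hasDerivAt_id t).const_mul μ
  have hexp := hlin.fun_neg.exp
  have hy := (hexp.mul_const (y₀ - u)).add_const u
  have hz := (((hexp.const_sub 1).const_mul (u * y₀)).const_add z₀).fun_add
    (((hexp.fun_add hlin).sub_const 1).const_mul (u ^ 2))
  have hG := (hz.fun_add (hy.const_mul σ)).fun_add (((hy.sub_const σ).log h).const_mul (σ ^ 2))
  refine hG.congr_deriv ?_
  field_simp
  ring

/-- for `μ > 0`, `σ < u₁ < 0 < u₂` and `u, y₀ ∈ [u₁,u₂]`, the
`y`-component of `φ` stays in `[u₁,u₂]` for `t ≥ 0`, `t ↦ G(φ(t))` has derivative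
`μ(u−σ) y(t)²/(y(t)−σ) ≥ 0`, and `G(φ(t)) > G(φ(0))` for `t > 0` whenever
`(y₀,u) ≠ (0,0)`. -/
theorem stmt17 (μ σ u₁ u₂ u y₀ x₀ z₀ : ℝ) (hμ : 0 < μ) (hσ : σ < u₁)
    (h₁ : u₁ < 0) (h₂ : 0 < u₂) (hu : u ∈ Icc u₁ u₂) (hy₀ : y₀ ∈ Icc u₁ u₂) :
    (∀ t : ℝ, 0 ≤ t → Real.exp (-(μ * t)) * (y₀ - u) + u ∈ Icc u₁ u₂) ∧
    (∀ t : ℝ, 0 ≤ t →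
      HasDerivAt (fun s : ℝ => G17 σ (φ17 μ u x₀ y₀ z₀ s))
        (μ * (u - σ) * (Real.exp (-(μ * t)) * (y₀ - u) + u) ^ 2 /
          (Real.exp (-(μ * t)) * (y₀ - u) + u - σ)) t ∧
      0 ≤ μ * (u - σ) * (Real.exp (-(μ * t)) * (y₀ - u) + u) ^ 2 /
          (Real.exp (-(μ * t)) * (y₀ - u) + u - σ)) ∧
    (((y₀, u) : ℝ × ℝ) ≠ (0, 0) → ∀ t : ℝ, 0 < t →
      G17 σ (φ17 μ u x₀ y₀ z₀ 0) < G17 σ (φ17 μ u x₀ y₀ z₀ t)) := by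
  have hy : ∀ t : ℝ, 0 ≤ t → Real.exp (-(μ * t)) * (y₀ - u) + u ∈ Icc u₁ u₂ :=
    fun t ht => exp_relaxation_mem_Icc hu hy₀ (mul_nonneg hμ.le ht)
  have hpos : ∀ t : ℝ, 0 ≤ t → 0 < Real.exp (-(μ * t)) * (y₀ - u) + u - σ :=
    fun t ht => by linarith [(hy t ht).1]
  have huσ : 0 < u - σ := by linarith [hu.1]
  have hderiv := fun t (ht : 0 ≤ t) => hasDerivAt_G17_φ17 x₀ z₀ (hpos t ht).ne'
  have hnonneg : ∀ t : ℝ, 0 ≤ t → 0 ≤ μ * (u - σ) * (Real.exp (-(μ * t)) * (y₀ - u) + u) ^ 2 /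
      (Real.exp (-(μ * t)) * (y₀ - u) + u - σ) :=
    fun t ht => div_nonneg (by positivity) (hpos t ht).le
  refine ⟨hy, fun t ht => ⟨hderiv t ht, hnonneg t ht⟩, fun hne t ht => ?_⟩
  have hzero : ∀ t : ℝ, 0 ≤ t → μ * (u - σ) * (Real.exp (-(μ * t)) * (y₀ - u) + u) ^ 2 /
      (Real.exp (-(μ * t)) * (y₀ - u) + u - σ) ≤ 0 →
      Real.exp (-(μ * t)) * (y₀ - u) + u = 0 := by
    intro t ht h
    have h0 := le_antisymm h (hnonneg t ht)
    simpa [(hpos t ht).ne', hμ.ne', huσ.ne'] using h0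
  have hslope : ∀ a b : ℝ, 0 ≤ a → a < b → ∃ c ∈ Ioo a b,
      μ * (u - σ) * (Real.exp (-(μ * c)) * (y₀ - u) + u) ^ 2 /
        (Real.exp (-(μ * c)) * (y₀ - u) + u - σ) * (b - a) =
      G17 σ (φ17 μ u x₀ y₀ z₀ b) - G17 σ (φ17 μ u x₀ y₀ z₀ a) := by
    intro a b ha hab
    obtain ⟨c, hc, h⟩ := exists_hasDerivAt_eq_slope
      (fun s : ℝ => G17 σ (φ17 μ u x₀ y₀ z₀ s)) _ hab
      (fun s hs => (hderiv s (ha.trans hs.1)).continuousAt.continuousWithinAt)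
      (fun s hs => hderiv s (ha.trans hs.1.le))
    exact ⟨c, hc, by rw [h, div_mul_cancel₀ _ (sub_pos.2 hab).ne']⟩
  by_contra! hle
  obtain ⟨a, ha, hGa⟩ := hslope 0 (t / 2) le_rfl (by linarith)
  obtain ⟨b, hb, hGb⟩ := hslope (t / 2) t (by linarith) (by linarith)
  have hb0 : 0 < b := by linarith [hb.1]
  have hda := hnonneg a ha.1.le
  have hdb := hnonneg b hb0.le
  have hya := hzero a ha.1.le (by nlinarith)
  have hyb := hzero b hb0.le (by nlinarith)
  have hexp : Real.exp (-(μ * b)) < Real.exp (-(μ * a)) :=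
    Real.exp_lt_exp.2 (neg_lt_neg (mul_lt_mul_of_pos_left (ha.2.trans hb.1) hμ))
  have hprod : (Real.exp (-(μ * a)) - Real.exp (-(μ * b))) * (y₀ - u) = 0 := by linarith
  have hyu : y₀ - u = 0 := (mul_eq_zero.1 hprod).resolve_left (sub_pos.2 hexp).ne'
  have hu0 : u = 0 := by simpa [hyu] using hya
  exact hne (Prod.ext (by simpa [hu0] using hyu) hu0)
end
end

section
/- For all μ ≠ 0 and u, x₀, y₀, z₀ ∈ ℝ, the curve φ(t) = (e^{μt}(x₀+u) − u, e^{−μt}(y₀−u) + u, z₀ + uy₀(1 − e^{−μt}) + u²(e^{−μt} + μt − 1)) is the unique solution of the ODE system ẋ = μ(x+u), ẏ = μ(−y+u), ż = uμy with initial condition φ(0) = (x₀,y₀,z₀). -/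
noncomputable section

/-- The curve `φ(t) = (e^{μt}(x₀+u) − u, e^{−μt}(y₀−u) + u,
z₀ + uy₀(1 − e^{−μt}) + u²(e^{−μt} + μt − 1))`. -/
def φ19 (μ u x₀ y₀ z₀ : ℝ) (t : ℝ) : ℝ × ℝ × ℝ :=
  (Real.exp (μ * t) * (x₀ + u) - u, Real.exp (-(μ * t)) * (y₀ - u) + u,
    z₀ + u * y₀ * (1 - Real.exp (-(μ * t))) + u ^ 2 * (Real.exp (-(μ * t)) + μ * t - 1))

/-- The affine vector field `(x, y, z) ↦ (μ(x+u), μ(−y+u), uμy)` is Lipschitz. -/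
theorem exists_lipschitzWith_field (μ u : ℝ) :
    ∃ K, LipschitzWith K
      (fun p : ℝ × ℝ × ℝ => (μ * (p.1 + u), μ * (-p.2.1 + u), u * μ * p.2.1)) := by
  let x := ContinuousLinearMap.fst ℝ ℝ (ℝ × ℝ)
  let y := (ContinuousLinearMap.fst ℝ ℝ ℝ).comp (ContinuousLinearMap.snd ℝ ℝ (ℝ × ℝ))
  let L : ℝ × ℝ × ℝ →L[ℝ] ℝ × ℝ × ℝ := (μ • x).prod ((-μ • y).prod ((u * μ) • y))
  refine ⟨‖L‖₊ + 0, ?_⟩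
  have h_eq : (fun p : ℝ × ℝ × ℝ => (μ * (p.1 + u), μ * (-p.2.1 + u), u * μ * p.2.1)) =
      fun p => L p + (μ * u, μ * u, (0 : ℝ)) := by
    ext p <;> simp [L, x, y] <;> ring
  rw [h_eq]
  exact L.lipschitz.add (LipschitzWith.const _)

theorem hasDerivAt_φ19 (μ u x₀ y₀ z₀ t : ℝ) :
    HasDerivAt (φ19 μ u x₀ y₀ z₀)
      (μ * ((φ19 μ u x₀ y₀ z₀ t).1 + u),
        μ * (-(φ19 μ u x₀ y₀ z₀ t).2.1 + u),
        u * μ * (φ19 μ u x₀ y₀ z₀ t).2.1) t := by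
  have hlin : HasDerivAt (fun t : ℝ => μ * t) μ t := by
    simpa using (hasDerivAt_id t).const_mul μ
  have hexp := hlin.exp
  have hexp_neg := hlin.fun_neg.exp
  refine HasDerivAt.prodMk ?_ (HasDerivAt.prodMk ?_ ?_)
  · refine ((hexp.mul_const (x₀ + u)).sub_const u).congr_deriv ?_
    simp only [φ19]
    ring
  · refine ((hexp_neg.mul_const (y₀ - u)).add_const u).congr_deriv ?_
    simp only [φ19]
    ring
  · refine ((((hexp_neg.const_sub 1).const_mul (u * y₀)).const_add z₀).add
      (((hexp_neg.add hlin).sub_const 1).const_mul (u ^ 2))).congr_deriv ?_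
    simp only [φ19]
    ring

/-- for `μ ≠ 0`, `φ19` is the unique solution of the ODE system
`ẋ = μ(x+u)`, `ẏ = μ(−y+u)`, `ż = uμy` with `φ(0) = (x₀,y₀,z₀)`. -/
theorem stmt19 (μ u x₀ y₀ z₀ : ℝ) (hμ : μ ≠ 0) :
    (∀ t : ℝ, HasDerivAt (φ19 μ u x₀ y₀ z₀)
      (μ * ((φ19 μ u x₀ y₀ z₀ t).1 + u),
        μ * (-(φ19 μ u x₀ y₀ z₀ t).2.1 + u),
        u * μ * (φ19 μ u x₀ y₀ z₀ t).2.1) t) ∧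
    φ19 μ u x₀ y₀ z₀ 0 = (x₀, y₀, z₀) ∧
    ∀ ψ : ℝ → ℝ × ℝ × ℝ,
      (∀ t : ℝ, HasDerivAt ψ
        (μ * ((ψ t).1 + u), μ * (-(ψ t).2.1 + u), u * μ * (ψ t).2.1) t) →
      ψ 0 = (x₀, y₀, z₀) → ψ = φ19 μ u x₀ y₀ z₀ := by
  have h_init : φ19 μ u x₀ y₀ z₀ 0 = (x₀, y₀, z₀) := by simp [φ19]
  refine ⟨hasDerivAt_φ19 μ u x₀ y₀ z₀, h_init, fun ψ hψ hψ0 => ?_⟩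
  obtain ⟨K, hK⟩ := exists_lipschitzWith_field μ u
  exact ODE_solution_unique_univ (t₀ := 0) (s := fun _ => Set.univ)
    (v := fun _ p => (μ * (p.1 + u), μ * (-p.2.1 + u), u * μ * p.2.1))
    (fun _ => hK.lipschitzOnWith) (fun t => ⟨hψ t, Set.mem_univ _⟩)
    (fun t => ⟨hasDerivAt_φ19 μ u x₀ y₀ z₀ t, Set.mem_univ _⟩) (hψ0.trans h_init.symm)
end
end
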